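/- arXiv:1409.4053 — 2 statements merged into one kernel-verified Lean document; each statement's English description precedes it below -/
import Mathlib

section
/- Suppose the pair (μ₁,μ₂) is perfect, let n ≥ 1 and m ≥ 0, and suppose real numbers c, a, b satisfy P_{n+1,m}(x) = (x − c)P_{n,m}(x) − a P_{n−1,m}(x) − b P_{n,m−1}(x) (the term with P_{n,m−1} omitted if m = 0). Then a = S_{n+1,m} S_{n−1,m} / S_{n,m}²; in particular a ≠ 0. -/
open MeasureTheory Polynomial

/-- The `k`-th moment of a measure `μ` on `ℝ`. -/
noncomputable def mom (μ : Measure ℝ) (k : ℕ) : ℝ := ∫ x, x ^ k ∂μ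

/-- The `(n+m)×(n+m)` moment matrix of the pair `(μ₁, μ₂)`: column `j` contains the
moments `s_{i+j}^{(1)}` for `j < n` and `s_{i+j-n}^{(2)}` for `n ≤ j < n+m`. -/
noncomputable def Smat (μ₁ μ₂ : Measure ℝ) (n m : ℕ) :
    Matrix (Fin (n + m)) (Fin (n + m)) ℝ :=
  Matrix.of fun i j =>
    if (j : ℕ) < n then mom μ₁ ((i : ℕ) + (j : ℕ))
    else mom μ₂ ((i : ℕ) + (j : ℕ) - n)

/-- The determinant `S_{n,m}` (with `S_{0,0} = 1`). -/
noncomputable def Sdet (μ₁ μ₂ : Measure ℝ) (n m : ℕ) : ℝ := (Smat μ₁ μ₂ n m).det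

/-- The `(n+m+1)×(n+m+1)` matrix over `ℝ[x]` whose determinant (normalized by `S_{n,m}`)
gives the multiple orthogonal polynomial `P_{n,m}`. -/
noncomputable def Pmat (μ₁ μ₂ : Measure ℝ) (n m : ℕ) :
    Matrix (Fin (n + m + 1)) (Fin (n + m + 1)) (Polynomial ℝ) :=
  Matrix.of fun i j =>
    if (j : ℕ) < n then C (mom μ₁ ((i : ℕ) + (j : ℕ)))
    else if (j : ℕ) < n + m then C (mom μ₂ ((i : ℕ) + (j : ℕ) - n))
    else X ^ (i : ℕ)

/-- The multiple orthogonal (Hermite–Padé) polynomial `P_{n,m}`. -/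
noncomputable def Ppoly (μ₁ μ₂ : Measure ℝ) (n m : ℕ) : Polynomial ℝ :=
  (Sdet μ₁ μ₂ n m)⁻¹ • (Pmat μ₁ μ₂ n m).det

/-- The moment matrix of the pair `(μ₁, μ₂)` bordered by the last column `u`. -/
noncomputable def borderedMat (μ₁ μ₂ : Measure ℝ) (n m : ℕ) (u : ℕ → ℝ) :
    Matrix (Fin (n + m + 1)) (Fin (n + m + 1)) ℝ :=
  Matrix.of fun i j =>
    if (j : ℕ) < n then mom μ₁ ((i : ℕ) + (j : ℕ))
    else if (j : ℕ) < n + m then mom μ₂ ((i : ℕ) + (j : ℕ) - n)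
    else u i

/-- Applying a linear functional to `det Pmat` amounts to applying it to the last column. -/
lemma map_det_Pmat (μ₁ μ₂ : Measure ℝ) (n m : ℕ) (L : ℝ[X] →ₗ[ℝ] ℝ) :
    L (Pmat μ₁ μ₂ n m).det =
      (borderedMat μ₁ μ₂ n m fun i => L (X ^ i)).det := by
  rw [Matrix.det_succ_column _ (Fin.last _), Matrix.det_succ_column _ (Fin.last _), map_sum]
  refine Finset.sum_congr rfl fun i _ => ?_
  have hminor : (Pmat μ₁ μ₂ n m).submatrix i.succAbove (Fin.last (n + m)).succAbove =
      C.mapMatrix ((borderedMat μ₁ μ₂ n m fun i => L (X ^ i)).submatrix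
        i.succAbove (Fin.last (n + m)).succAbove) := by
    ext1 k l
    have hl := l.isLt
    by_cases h : (l : ℕ) < n <;> simp [Pmat, borderedMat, h]
  rw [hminor, ← RingHom.map_det]
  have hcol : Pmat μ₁ μ₂ n m i (Fin.last _) = X ^ (i : ℕ) := by simp [Pmat]
  have hcol' : borderedMat μ₁ μ₂ n m (fun i => L (X ^ i)) i (Fin.last _) = L (X ^ (i : ℕ)) := by
    simp [borderedMat]
  rw [hcol, hcol']
  generalize ((borderedMat μ₁ μ₂ n m fun i => L (X ^ i)).submatrix
    i.succAbove (Fin.last (n + m)).succAbove).det = d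
  have : (-1 : ℝ[X]) ^ ((i : ℕ) + (Fin.last (n + m) : ℕ)) * X ^ (i : ℕ) * C d =
      ((-1 : ℝ) ^ ((i : ℕ) + (Fin.last (n + m) : ℕ)) * d) • X ^ (i : ℕ) := by
    rw [smul_eq_C_mul]
    simp only [map_mul, map_pow, map_neg, map_one]
    ring
  rw [this, map_smul, smul_eq_mul]
  ring

lemma det_borderedMat_of_lt (μ₁ μ₂ : Measure ℝ) {n m k : ℕ} (hk : k < n) :
    (borderedMat μ₁ μ₂ n m fun i => mom μ₁ (i + k)).det = 0 := by
  have hne : (⟨k, by omega⟩ : Fin (n + m + 1)) ≠ Fin.last (n + m) := by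
    simp [Fin.ext_iff]
    omega
  refine Matrix.det_zero_of_column_eq hne fun i => ?_
  simp [borderedMat, hk]

lemma det_borderedMat_self (μ₁ μ₂ : Measure ℝ) (n m : ℕ) :
    (borderedMat μ₁ μ₂ n m fun i => mom μ₁ (i + n)).det = (-1) ^ m * Sdet μ₁ μ₂ (n + 1) m := by
  have hnm : n + m + 1 = n + 1 + m := by omega
  rw [Sdet, ← Matrix.det_submatrix_equiv_self (finCongr hnm),
    Matrix.det_succ_column _ (Fin.last _),
    Matrix.det_succ_column _ (⟨n, by omega⟩ : Fin (n + m + 1)), Finset.mul_sum]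
  refine Finset.sum_congr rfl fun i _ => ?_
  have hminor : (borderedMat μ₁ μ₂ n m fun i => mom μ₁ (i + n)).submatrix
        i.succAbove (Fin.last (n + m)).succAbove =
      ((Smat μ₁ μ₂ (n + 1) m).submatrix (finCongr hnm) (finCongr hnm)).submatrix
        i.succAbove (⟨n, by omega⟩ : Fin (n + m + 1)).succAbove := by
    ext k l
    have hl := l.isLt
    by_cases h : (l : ℕ) < n
    · simp [borderedMat, Smat, Fin.succAbove, Fin.lt_def, h]
      omega
    · simp [borderedMat, Smat, Fin.succAbove, Fin.lt_def, h]
      congr 1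
      omega
  rw [hminor]
  simp only [borderedMat, Smat, Matrix.of_apply, Matrix.submatrix_apply, finCongr_apply,
    Fin.val_last, Fin.val_cast]
  rw [if_neg (by omega), if_neg (by omega), if_pos (by omega)]
  ring

/-- The functional `p ↦ ∫ x ^ k * p x ∂μ`, defined through the moments of `μ`. -/
noncomputable def momFunctional (μ : Measure ℝ) (k : ℕ) : ℝ[X] →ₗ[ℝ] ℝ :=
  (basisMonomials ℝ).constr ℝ fun i => mom μ (i + k)

lemma momFunctional_X_pow (μ : Measure ℝ) (k i : ℕ) :
    momFunctional μ k (X ^ i) = mom μ (i + k) := by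
  have := (basisMonomials ℝ).constr_basis ℝ (fun i => mom μ (i + k)) i
  simpa only [momFunctional, coe_basisMonomials, ← X_pow_eq_monomial] using this

lemma momFunctional_X_mul (μ : Measure ℝ) (k : ℕ) (p : ℝ[X]) :
    momFunctional μ k (X * p) = momFunctional μ (k + 1) p := by
  induction p using Polynomial.induction_on' with
  | add p q hp hq => rw [mul_add, map_add, map_add, hp, hq]
  | monomial i r =>
    rw [← smul_X_eq_monomial, mul_smul_comm, ← pow_succ', map_smul, map_smul,
      momFunctional_X_pow, momFunctional_X_pow, add_right_comm, add_assoc]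

lemma momFunctional_C_mul (μ : Measure ℝ) (k : ℕ) (r : ℝ) (p : ℝ[X]) :
    momFunctional μ k (C r * p) = r * momFunctional μ k p := by
  rw [← smul_eq_C_mul, map_smul, smul_eq_mul]

lemma momFunctional_Ppoly_of_lt (μ₁ μ₂ : Measure ℝ) {n m k : ℕ} (hk : k < n) :
    momFunctional μ₁ k (Ppoly μ₁ μ₂ n m) = 0 := by
  rw [Ppoly, map_smul, map_det_Pmat]
  simp only [momFunctional_X_pow]
  rw [det_borderedMat_of_lt μ₁ μ₂ hk, smul_zero]

lemma momFunctional_Ppoly_self (μ₁ μ₂ : Measure ℝ) (n m : ℕ) :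
    momFunctional μ₁ n (Ppoly μ₁ μ₂ n m) =
      (-1) ^ m * (Sdet μ₁ μ₂ (n + 1) m / Sdet μ₁ μ₂ n m) := by
  rw [Ppoly, map_smul, map_det_Pmat]
  simp only [momFunctional_X_pow]
  rw [det_borderedMat_self, smul_eq_mul]
  ring

/-- For a perfect system, the recurrence coefficient `a` in the nearest-neighbor
recurrence in the `n`-direction equals `S_{n+1,m} S_{n-1,m} / S_{n,m}²`;
in particular it is nonzero. -/
theorem recurrence_coefficient_a (μ₁ μ₂ : Measure ℝ)
    (h₁ : ∀ k : ℕ, Integrable (fun x => x ^ k) μ₁)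
    (h₂ : ∀ k : ℕ, Integrable (fun x => x ^ k) μ₂)
    (hperfect : ∀ n m : ℕ, Sdet μ₁ μ₂ n m ≠ 0)
    (n m : ℕ) (hn : 1 ≤ n) (c a b : ℝ)
    (hrec : Ppoly μ₁ μ₂ (n + 1) m =
      (X - C c) * Ppoly μ₁ μ₂ n m - C a * Ppoly μ₁ μ₂ (n - 1) m
        - (if m = 0 then 0 else C b * Ppoly μ₁ μ₂ n (m - 1))) :
    a = Sdet μ₁ μ₂ (n + 1) m * Sdet μ₁ μ₂ (n - 1) m / (Sdet μ₁ μ₂ n m) ^ 2 ∧ a ≠ 0 := by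
  obtain ⟨k, rfl⟩ : ∃ k, n = k + 1 := ⟨n - 1, by omega⟩
  have hb : momFunctional μ₁ k
      (if m = 0 then 0 else C b * Ppoly μ₁ μ₂ (k + 1) (m - 1)) = 0 := by
    split_ifs
    · exact map_zero _
    · rw [momFunctional_C_mul, momFunctional_Ppoly_of_lt μ₁ μ₂ k.lt_succ_self, mul_zero]
  have h := congrArg (momFunctional μ₁ k) hrec
  rw [Nat.add_sub_cancel, map_sub, map_sub, hb, sub_mul, map_sub, momFunctional_X_mul,
    momFunctional_C_mul, momFunctional_C_mul,
    momFunctional_Ppoly_of_lt μ₁ μ₂ (show k < k + 1 + 1 by omega),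
    momFunctional_Ppoly_of_lt μ₁ μ₂ k.lt_succ_self,
    momFunctional_Ppoly_self, momFunctional_Ppoly_self] at h
  have h0 := hperfect k m
  have h1 := hperfect (k + 1) m
  have h2 := hperfect (k + 1 + 1) m
  have hquot : a * (Sdet μ₁ μ₂ (k + 1) m / Sdet μ₁ μ₂ k m) =
      Sdet μ₁ μ₂ (k + 1 + 1) m / Sdet μ₁ μ₂ (k + 1) m :=
    mul_left_cancel₀ (pow_ne_zero m (neg_ne_zero.mpr one_ne_zero) : (-1 : ℝ) ^ m ≠ 0)
      (by linear_combination h)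
  have ha : a = Sdet μ₁ μ₂ (k + 1 + 1) m * Sdet μ₁ μ₂ k m / Sdet μ₁ μ₂ (k + 1) m ^ 2 := by
    field_simp at hquot ⊢
    linear_combination hquot
  rw [Nat.add_sub_cancel]
  exact ⟨ha, ha ▸ div_ne_zero (mul_ne_zero h2 h0) (pow_ne_zero 2 h1)⟩
end

section
/- Suppose the pair (μ₁,μ₂) is perfect and let a, b, c, d : ℕ×ℕ → ℝ (with a_{0,m} = 0 = b_{n,0}) be the coefficients of the nearest-neighbor recurrence relations for the multiple orthogonal polynomials P_{n,m}. Then there exist functions α^{(2)}, α^{(3)}, α^{(4)}, α^{(5)} : ℕ×ℕ → ℝ with α^{(4)}_{n,m} α^{(2)}_{n,m} = −a_{n,m} and α^{(5)}_{n,m} α^{(3)}_{n,m} = −b_{n,m} for all n,m ≥ 0, such that, setting α^{(1)}_{n,m} = −c_{n,m} and β^{(1)}_{n,m} = −d_{n,m}, the 3×3 polynomial matrices L_{n,m} and M_{n,m} of the stated form satisfy the zero curvature condition L_{n,m+1} M_{n,m} = M_{n+1,m} L_{n,m} for all n,m ≥ 0. -/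
open MeasureTheory Polynomial

/-- The transition matrix `L_{n,m}` over `ℝ[x]`. -/
noncomputable def LmatR (α1 α2 α3 α4 α5 : ℕ → ℕ → ℝ) (n m : ℕ) :
    Matrix (Fin 3) (Fin 3) (Polynomial ℝ) :=
  !![X + C (α1 n m), C (α2 n m), C (α3 n m);
     C (α4 (n + 1) m), 0, 0;
     C (α5 (n + 1) m), 0, 1]

/-- The transition matrix `M_{n,m}` over `ℝ[x]`. -/
noncomputable def MmatR (β1 α2 α3 α4 α5 : ℕ → ℕ → ℝ) (n m : ℕ) :
    Matrix (Fin 3) (Fin 3) (Polynomial ℝ) :=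
  !![X + C (β1 n m), C (α2 n m), C (α3 n m);
     C (α4 n (m + 1)), 1, 0;
     C (α5 n (m + 1)), 0, 0]

section Bordered

variable {R : Type*} [CommRing R] {k : ℕ}

/-- The signed maximal minor of `N` obtained by deleting row `i`: the cofactor of the entry `i` of
a column appended to `N`. -/
def borderCofactor (N : Matrix (Fin (k + 1)) (Fin k) R) (i : Fin (k + 1)) : R :=
  (-1) ^ ((i : ℕ) + k) * (N.submatrix i.succAbove id).det

/-- The square matrix obtained from `N` by appending the column `w`. -/
def bordered (N : Matrix (Fin (k + 1)) (Fin k) R) (w : Fin (k + 1) → R) :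
    Matrix (Fin (k + 1)) (Fin (k + 1)) R :=
  Matrix.of fun i => Fin.snoc (α := fun _ => R) (N i) (w i)

theorem det_bordered (N : Matrix (Fin (k + 1)) (Fin k) R) (w : Fin (k + 1) → R) :
    (bordered N w).det = ∑ i, borderCofactor N i * w i := by
  rw [Matrix.det_succ_column _ (Fin.last k)]
  refine Finset.sum_congr rfl fun i _ => ?_
  have h : (bordered N w).submatrix i.succAbove (Fin.last k).succAbove =
      N.submatrix i.succAbove id := by
    ext r s
    simp [bordered]
  rw [h]
  simp only [borderCofactor, bordered, Matrix.of_apply, Fin.snoc_last, Fin.val_last]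
  ring

theorem sum_borderCofactor_mul_col (N : Matrix (Fin (k + 1)) (Fin k) R) (j : Fin k) :
    ∑ i, borderCofactor N i * N i j = 0 := by
  rw [← det_bordered N fun i => N i j]
  refine Matrix.det_zero_of_column_eq (Fin.castSucc_lt_last j).ne fun i => ?_
  simp [bordered]

theorem borderCofactor_map {S : Type*} [CommRing S] (f : R →+* S)
    (N : Matrix (Fin (k + 1)) (Fin k) R) (i : Fin (k + 1)) :
    borderCofactor (N.map f) i = f (borderCofactor N i) := by
  simp [borderCofactor, RingHom.map_det, Matrix.submatrix_map]

end Bordered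

section MomentMatrix

variable (μ₁ μ₂ : Measure ℝ) (n m : ℕ)

/-- The `(n+m+1)×(n+m)` matrix of moments occurring in the definition of `P_{n,m}`. -/
noncomputable def momentMatrix : Matrix (Fin (n + m + 1)) (Fin (n + m)) ℝ :=
  Matrix.of fun i j =>
    if (j : ℕ) < n then mom μ₁ ((i : ℕ) + (j : ℕ))
    else mom μ₂ ((i : ℕ) + (j : ℕ) - n)

theorem Pmat_eq_bordered :
    Pmat μ₁ μ₂ n m = bordered ((momentMatrix μ₁ μ₂ n m).map C) fun i => X ^ (i : ℕ) := by
  ext1 i j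
  refine Fin.lastCases ?_ (fun j => ?_) j
  · simp [Pmat, bordered]
  · simp only [Pmat, bordered, momentMatrix, Matrix.of_apply, Matrix.map_apply, Fin.snoc_castSucc,
      Fin.val_castSucc, j.isLt, if_true]
    split_ifs <;> rfl

theorem det_Pmat :
    (Pmat μ₁ μ₂ n m).det =
      ∑ i, C (borderCofactor (momentMatrix μ₁ μ₂ n m) i) * X ^ (i : ℕ) := by
  simp only [Pmat_eq_bordered, det_bordered, borderCofactor_map]

theorem borderCofactor_momentMatrix_last :
    borderCofactor (momentMatrix μ₁ μ₂ n m) (Fin.last (n + m)) = Sdet μ₁ μ₂ n m := by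
  have h : (momentMatrix μ₁ μ₂ n m).submatrix (Fin.last (n + m)).succAbove id =
      Smat μ₁ μ₂ n m := by
    ext i j
    simp [momentMatrix, Smat]
  rw [borderCofactor, h, Fin.val_last, ← two_mul, pow_mul]
  simp [Sdet]

theorem coeff_Ppoly (i : Fin (n + m + 1)) :
    (Ppoly μ₁ μ₂ n m).coeff i =
      (Sdet μ₁ μ₂ n m)⁻¹ * borderCofactor (momentMatrix μ₁ μ₂ n m) i := by
  simp [Ppoly, det_Pmat, coeff_X_pow, Fin.val_inj]

theorem degree_Ppoly_lt : (Ppoly μ₁ μ₂ n m).degree < (n + m + 1 : ℕ) := by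
  refine (degree_smul_le _ _).trans_lt ?_
  rw [det_Pmat]
  exact degree_sum_fin_lt _

variable {μ₁ μ₂ n m}

theorem coeff_Ppoly_add (h : Sdet μ₁ μ₂ n m ≠ 0) : (Ppoly μ₁ μ₂ n m).coeff (n + m) = 1 := by
  have := coeff_Ppoly μ₁ μ₂ n m (Fin.last (n + m))
  rwa [borderCofactor_momentMatrix_last, inv_mul_cancel₀ h] at this

theorem natDegree_Ppoly_le : (Ppoly μ₁ μ₂ n m).natDegree ≤ n + m :=
  natDegree_le_iff_degree_le.2 (Order.lt_succ_iff.1 (degree_Ppoly_lt μ₁ μ₂ n m))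

theorem sum_coeff_Ppoly_mul_momentMatrix (j : Fin (n + m)) :
    ∑ i, (Ppoly μ₁ μ₂ n m).coeff (i : Fin (n + m + 1)) * momentMatrix μ₁ μ₂ n m i j = 0 := by
  simp only [coeff_Ppoly, mul_assoc, ← Finset.mul_sum, sum_borderCofactor_mul_col, mul_zero]

theorem sum_coeff_Ppoly_mul_mom_left {k : ℕ} (hk : k < n) :
    ∑ i ∈ Finset.range (n + m + 1), (Ppoly μ₁ μ₂ n m).coeff i * mom μ₁ (i + k) = 0 := by
  rw [Finset.sum_range]
  simpa [momentMatrix, hk] using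
    sum_coeff_Ppoly_mul_momentMatrix (μ₁ := μ₁) (μ₂ := μ₂) (⟨k, by omega⟩ : Fin (n + m))

theorem sum_coeff_Ppoly_mul_mom_right {k : ℕ} (hk : k < m) :
    ∑ i ∈ Finset.range (n + m + 1), (Ppoly μ₁ μ₂ n m).coeff i * mom μ₂ (i + k) = 0 := by
  rw [Finset.sum_range, ← sum_coeff_Ppoly_mul_momentMatrix (μ₁ := μ₁) (μ₂ := μ₂)
    (⟨n + k, by omega⟩ : Fin (n + m))]
  refine Finset.sum_congr rfl fun i _ => ?_
  rw [momentMatrix, Matrix.of_apply, if_neg (by simp)]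
  congr 2
  change _ = (i : ℕ) + (n + k) - n
  omega

theorem Ppoly_succ_right_ne_succ_left (h : Sdet μ₁ μ₂ n (m + 1) ≠ 0)
    (h' : Sdet μ₁ μ₂ (n + 1) (m + 1) ≠ 0) :
    Ppoly μ₁ μ₂ n (m + 1) ≠ Ppoly μ₁ μ₂ (n + 1) m := by
  intro heq
  refine h' (Matrix.exists_vecMul_eq_zero_iff.1
    ⟨fun i : Fin (n + 1 + (m + 1)) => (Ppoly μ₁ μ₂ n (m + 1)).coeff i, fun h0 => ?_, ?_⟩)
  · have := congrFun h0 ⟨n + (m + 1), by omega⟩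
    simp [coeff_Ppoly_add h] at this
  · ext j
    by_cases hj : (j : ℕ) < n + 1
    · have := sum_coeff_Ppoly_mul_mom_left (μ₁ := μ₁) (μ₂ := μ₂) (m := m) hj
      rw [← heq, show n + 1 + m + 1 = n + 1 + (m + 1) by omega, Finset.sum_range] at this
      simpa only [Matrix.vecMul, dotProduct, Smat, Matrix.of_apply, Pi.zero_apply, if_pos hj] using this
    · have hk : (j : ℕ) - (n + 1) < m + 1 := by omega
      have := sum_coeff_Ppoly_mul_mom_right (μ₁ := μ₁) (μ₂ := μ₂) (n := n) hk
      rw [show n + (m + 1) + 1 = n + 1 + (m + 1) by omega, Finset.sum_range] at this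
      simpa only [Matrix.vecMul, dotProduct, Smat, Matrix.of_apply, Pi.zero_apply, if_neg hj,
        Nat.add_sub_assoc (not_lt.1 hj)] using this

end MomentMatrix

section Compatibility

theorem linear_mul_monic_add_eq_zero {P Q : ℝ[X]} {k : ℕ} {s t : ℝ} (hP : P.natDegree ≤ k)
    (hP1 : P.coeff k = 1) (hQ : Q.degree < k) (h : (C s * X + C t) * P + Q = 0) :
    s = 0 ∧ t = 0 ∧ Q = 0 := by
  have hs : s = 0 := by
    have := congrArg (coeff · (k + 1)) h
    simpa [add_mul, mul_assoc, coeff_X_mul, hP1,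
      coeff_eq_zero_of_natDegree_lt (hP.trans_lt k.lt_succ_self),
      coeff_eq_zero_of_degree_lt (hQ.trans (WithBot.coe_lt_coe.2 k.lt_succ_self))] using this
  have ht : t = 0 := by
    have := congrArg (coeff · k) h
    simpa [hs, hP1, coeff_eq_zero_of_degree_lt hQ] using this
  exact ⟨hs, ht, by simpa [hs, ht] using h⟩

variable {P : ℕ → ℕ → ℝ[X]} {a b c d : ℕ → ℕ → ℝ}
  (hdeg : ∀ n m, (P n m).natDegree ≤ n + m) (hlead : ∀ n m, (P n m).coeff (n + m) = 1)
  (ha0 : ∀ m, a 0 m = 0) (hb0 : ∀ n, b n 0 = 0)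
  (hrec1 : ∀ n m, P (n + 1) m = (X - C (c n m)) * P n m
    - (if n = 0 then 0 else C (a n m) * P (n - 1) m)
    - (if m = 0 then 0 else C (b n m) * P n (m - 1)))
  (hrec2 : ∀ n m, P n (m + 1) = (X - C (d n m)) * P n m
    - (if n = 0 then 0 else C (a n m) * P (n - 1) m)
    - (if m = 0 then 0 else C (b n m) * P n (m - 1)))

include hrec1 hrec2 in
theorem sub_eq_C_mul_of_recurrence (n m : ℕ) :
    P n (m + 1) - P (n + 1) m = C (c n m - d n m) * P n m := by
  rw [hrec1, hrec2, C_sub]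
  ring

include hdeg hlead ha0 hb0 hrec1 hrec2 in
theorem compatibility_of_recurrence (n m : ℕ) :
    c n (m + 1) + d n m = d (n + 1) m + c n m ∧
    c n (m + 1) * d n m - a n (m + 1) - b n (m + 1) =
      d (n + 1) m * c n m - a (n + 1) m - b (n + 1) m ∧
    C ((c n m - d n m) * a n m - (c (n - 1) m - d (n - 1) m) * a n (m + 1)) *
        (if n = 0 then 0 else P (n - 1) m) +
      C ((c n m - d n m) * b n m - (c n (m - 1) - d n (m - 1)) * b (n + 1) m) *
        (if m = 0 then 0 else P n (m - 1)) = 0 := by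
  have hU : ∀ n m, C (a n (m + 1)) * (if n = 0 then 0 else P (n - 1) (m + 1)) =
      C (a n (m + 1)) * (P n m + C (c (n - 1) m - d (n - 1) m) *
        (if n = 0 then 0 else P (n - 1) m)) := by
    rintro (_ | n) m
    · simp [ha0]
    · simp [-map_sub, ← sub_eq_C_mul_of_recurrence hrec1 hrec2 n m]
  have hV : ∀ n m, C (b (n + 1) m) * (if m = 0 then 0 else P (n + 1) (m - 1)) =
      C (b (n + 1) m) * (P n m - C (c n (m - 1) - d n (m - 1)) *
        (if m = 0 then 0 else P n (m - 1))) := by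
    rintro n (_ | m)
    · simp [hb0]
    · simp [-map_sub, ← sub_eq_C_mul_of_recurrence hrec1 hrec2 n m]
  have hrec1' : ∀ n m, P (n + 1) m = (X - C (c n m)) * P n m
      - C (a n m) * (if n = 0 then 0 else P (n - 1) m)
      - C (b n m) * (if m = 0 then 0 else P n (m - 1)) := by
    simpa only [mul_ite, mul_zero] using hrec1
  have hrec2' : ∀ n m, P n (m + 1) = (X - C (d n m)) * P n m
      - C (a n m) * (if n = 0 then 0 else P (n - 1) m)
      - C (b n m) * (if m = 0 then 0 else P n (m - 1)) := by
    simpa only [mul_ite, mul_zero] using hrec2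
  have key : (C (d (n + 1) m + c n m - (c n (m + 1) + d n m)) * X +
      C (c n (m + 1) * d n m - a n (m + 1) - b n (m + 1) -
        (d (n + 1) m * c n m - a (n + 1) m - b (n + 1) m))) * P n m +
      (C ((c n (m + 1) - d (n + 1) m) * a n m - (c (n - 1) m - d (n - 1) m) * a n (m + 1)) *
        (if n = 0 then 0 else P (n - 1) m) +
      C ((c n (m + 1) - d (n + 1) m) * b n m - (c n (m - 1) - d n (m - 1)) * b (n + 1) m) *
        (if m = 0 then 0 else P n (m - 1))) = 0 := by
    have e1 := hrec1' n (m + 1)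
    have e2 := hrec2' (n + 1) m
    rw [hU n m, hrec2' n m] at e1
    rw [hV n m, hrec1' n m] at e2
    simp only [Nat.add_eq_zero_iff, one_ne_zero, and_false, if_false, add_tsub_cancel_right]
      at e1 e2
    simp only [C_add, C_sub, C_mul] at e1 e2 ⊢
    linear_combination e2 - e1
  have hlt : ∀ i j, i + j < n + m → (P i j).degree < (n + m : ℕ) := fun i j h =>
    degree_le_natDegree.trans_lt (Nat.cast_lt.2 ((hdeg i j).trans_lt h))
  have hC : ∀ (r : ℝ) (Q : ℝ[X]), Q.degree < (n + m : ℕ) → (C r * Q).degree < (n + m : ℕ) :=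
    fun r Q h => by
      rw [C_mul']
      exact (degree_smul_le r Q).trans_lt h
  have hUdeg : (if n = 0 then 0 else P (n - 1) m).degree < (n + m : ℕ) := by
    split_ifs
    · simp
    · exact hlt _ _ (by omega)
  have hVdeg : (if m = 0 then 0 else P n (m - 1)).degree < (n + m : ℕ) := by
    split_ifs
    · simp
    · exact hlt _ _ (by omega)
  obtain ⟨hs, ht, hQ⟩ := linear_mul_monic_add_eq_zero (hdeg n m) (hlead n m)
    ((degree_add_le _ _).trans_lt (max_lt (hC _ _ hUdeg) (hC _ _ hVdeg))) key
  have hcd : c n (m + 1) - d (n + 1) m = c n m - d n m := by linarith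
  rw [hcd] at hQ
  exact ⟨by linarith, by linarith, hQ⟩

include hdeg hlead ha0 hb0 hrec1 hrec2 in
theorem coeff_relations_of_recurrence (hcd : ∀ n m, c n m - d n m ≠ 0) (n m : ℕ) :
    (c (n + 1) m - d (n + 1) m) * a (n + 1) m = (c n m - d n m) * a (n + 1) (m + 1) ∧
    (c n (m + 1) - d n (m + 1)) * b n (m + 1) = (c n m - d n m) * b (n + 1) (m + 1) := by
  have hP : ∀ i j, P i j ≠ 0 := fun i j h => by simpa [h] using hlead i j
  have hind : ∀ i j (r s : ℝ), C r * P i (j + 1) + C s * P (i + 1) j = 0 → r = 0 ∧ s = 0 := by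
    intro i j r s h
    have hadd : r + s = 0 := by
      have h1 := hlead i (j + 1)
      have h2 := hlead (i + 1) j
      rw [show i + 1 + j = i + (j + 1) by omega] at h2
      simpa [h1, h2] using congrArg (coeff · (i + (j + 1))) h
    have hr : C (r * (c i j - d i j)) * P i j = 0 := by
      rw [C_mul, mul_assoc, ← sub_eq_C_mul_of_recurrence hrec1 hrec2, ← h,
        show s = -r by linarith, C_neg]
      ring
    have : r = 0 := by simpa [-map_sub, hP, hcd] using hr
    exact ⟨this, by linarith⟩
  constructor
  · have h := (compatibility_of_recurrence hdeg hlead ha0 hb0 hrec1 hrec2 (n + 1) m).2.2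
    rw [← sub_eq_zero]
    rcases m with _ | m
    · simpa [hP, -map_sub, -map_mul] using h
    · exact (hind n m _ _ (by simpa [-map_sub, -map_mul] using h)).1
  · have h := (compatibility_of_recurrence hdeg hlead ha0 hb0 hrec1 hrec2 n (m + 1)).2.2
    rw [← sub_eq_zero]
    rcases n with _ | n
    · simpa [hP, -map_sub, -map_mul] using h
    · exact (hind n m _ _ (by simpa [-map_sub, -map_mul] using h)).2

end Compatibility

/-- For a perfect system, the nearest-neighbor recurrence coefficients give rise to
transition matrices satisfying the zero curvature condition. -/
theorem perfect_system_gives_zero_curvature (μ₁ μ₂ : Measure ℝ)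
    (h₁ : ∀ k : ℕ, Integrable (fun x => x ^ k) μ₁)
    (h₂ : ∀ k : ℕ, Integrable (fun x => x ^ k) μ₂)
    (hperfect : ∀ n m : ℕ, Sdet μ₁ μ₂ n m ≠ 0)
    (a b c d : ℕ → ℕ → ℝ)
    (ha0 : ∀ m, a 0 m = 0) (hb0 : ∀ n, b n 0 = 0)
    (hrec1 : ∀ n m : ℕ,
      Ppoly μ₁ μ₂ (n + 1) m =
        (X - C (c n m)) * Ppoly μ₁ μ₂ n m
          - (if n = 0 then 0 else C (a n m) * Ppoly μ₁ μ₂ (n - 1) m)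
          - (if m = 0 then 0 else C (b n m) * Ppoly μ₁ μ₂ n (m - 1)))
    (hrec2 : ∀ n m : ℕ,
      Ppoly μ₁ μ₂ n (m + 1) =
        (X - C (d n m)) * Ppoly μ₁ μ₂ n m
          - (if n = 0 then 0 else C (a n m) * Ppoly μ₁ μ₂ (n - 1) m)
          - (if m = 0 then 0 else C (b n m) * Ppoly μ₁ μ₂ n (m - 1))) :
    ∃ α2 α3 α4 α5 : ℕ → ℕ → ℝ,
      (∀ n m : ℕ, α4 n m * α2 n m = -a n m) ∧
      (∀ n m : ℕ, α5 n m * α3 n m = -b n m) ∧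
      (∀ n m : ℕ,
        LmatR (fun n m => -c n m) α2 α3 α4 α5 n (m + 1) *
            MmatR (fun n m => -d n m) α2 α3 α4 α5 n m =
          MmatR (fun n m => -d n m) α2 α3 α4 α5 (n + 1) m *
            LmatR (fun n m => -c n m) α2 α3 α4 α5 n m) := by
  have hdeg : ∀ n m, (Ppoly μ₁ μ₂ n m).natDegree ≤ n + m := fun _ _ => natDegree_Ppoly_le
  have hlead : ∀ n m, (Ppoly μ₁ μ₂ n m).coeff (n + m) = 1 :=
    fun n m => coeff_Ppoly_add (hperfect n m)
  have hcd : ∀ n m, c n m - d n m ≠ 0 := fun n m h => by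
    refine Ppoly_succ_right_ne_succ_left (hperfect n (m + 1)) (hperfect (n + 1) (m + 1)) ?_
    rw [← sub_eq_zero, sub_eq_C_mul_of_recurrence hrec1 hrec2, h, C_0, zero_mul]
  let u : ℕ → ℕ → ℝ := fun n m => ∏ k ∈ Finset.range m, (c n k - d n k)
  let v : ℕ → ℕ → ℝ := fun n m => ∏ k ∈ Finset.range n, (d k m - c k m)
  have hu0 : ∀ n m, u n m ≠ 0 := fun n m => Finset.prod_ne_zero_iff.2 fun k _ => hcd n k
  have hv0 : ∀ n m, v n m ≠ 0 := fun n m =>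
    Finset.prod_ne_zero_iff.2 fun k _ h => hcd k m (by linarith)
  have hus : ∀ n m, u n (m + 1) = u n m * (c n m - d n m) :=
    fun n m => Finset.prod_range_succ _ _
  have hvs : ∀ n m, v (n + 1) m = v n m * (d n m - c n m) :=
    fun n m => Finset.prod_range_succ _ _
  refine ⟨u, v, fun n m => -a n m / u n m, fun n m => -b n m / v n m,
    fun n m => div_mul_cancel₀ _ (hu0 n m), fun n m => div_mul_cancel₀ _ (hv0 n m),
    fun n m => ?_⟩
  obtain ⟨h1, h2, -⟩ := compatibility_of_recurrence hdeg hlead ha0 hb0 hrec1 hrec2 n m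
  obtain ⟨h3, h4⟩ := coeff_relations_of_recurrence hdeg hlead ha0 hb0 hrec1 hrec2 hcd n m
  have h5 : -a (n + 1) m / u (n + 1) m =
      -a (n + 1) (m + 1) / u (n + 1) (m + 1) * (c n m - d n m) := by
    have := hcd (n + 1) m
    have := hu0 (n + 1) m
    rw [hus]
    field_simp
    linear_combination -h3
  have h6 : -b n (m + 1) / v n (m + 1) =
      -b (n + 1) (m + 1) / v (n + 1) (m + 1) * (d n m - c n m) := by
    have : d n (m + 1) - c n (m + 1) ≠ 0 := fun h => hcd n (m + 1) (by linarith)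
    have := hv0 n (m + 1)
    have : d n m - c n m ≠ 0 := fun h => hcd n m (by linarith)
    rw [hvs]
    field_simp
    linear_combination h4
  have hau : ∀ n m, (C (u n m) * C (-a n m / u n m) : ℝ[X]) = -C (a n m) := fun n m => by
    rw [← C_mul, mul_div_cancel₀ _ (hu0 n m), C_neg]
  have hbv : ∀ n m, (C (v n m) * C (-b n m / v n m) : ℝ[X]) = -C (b n m) := fun n m => by
    rw [← C_mul, mul_div_cancel₀ _ (hv0 n m), C_neg]
  have h1' := congrArg (C : ℝ → ℝ[X]) h1
  have h2' := congrArg (C : ℝ → ℝ[X]) h2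
  have h5' := congrArg (C : ℝ → ℝ[X]) h5
  have h6' := congrArg (C : ℝ → ℝ[X]) h6
  have hus' := congrArg (C : ℝ → ℝ[X]) (hus n m)
  have hvs' := congrArg (C : ℝ → ℝ[X]) (hvs n m)
  simp only [C_add, C_sub, C_mul] at h1' h2' h5' h6' hus' hvs'
  ext1 i j
  fin_cases i <;> fin_cases j <;>
    simp [LmatR, MmatR, Matrix.mul_apply, Fin.sum_univ_three, hau, hbv]
  · linear_combination h2' - X * h1'
  · linear_combination hus' - C (u n m) * h1'
  · linear_combination -hvs' - C (v n m) * h1'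
  · linear_combination -h5'
  · linear_combination h6'
end
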